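/- arXiv:2603.23380 — 4 statements merged into one kernel-verified Lean document; each statement's English description precedes it below -/
import Mathlib

section
/- For every integer n ≥ 1, S_{2n-1} = (−1)^{n−1} · T_{2n−1}, where T_{2n−1} is the number of up-down alternating permutations of Fin (2n−1); in particular |S_{2n-1}| equals the tangent number T_{2n−1}. -/
/-- The excedance number of a permutation: the number of indices `i` with `σ i > i`. -/
def exc {n : ℕ} (σ : Equiv.Perm (Fin n)) : ℕ :=
  (Finset.univ.filter fun i : Fin n => i < σ i).card

/-- The alternating sum of excedances over all permutations of `Fin n`. -/
def S (n : ℕ) : ℤ :=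
  ∑ σ : Equiv.Perm (Fin n), (-1 : ℤ) ^ exc σ

/-- A permutation of `Fin m` is up-down alternating if it ascends at even positions
and descends at odd positions. -/
def IsUpDown {m : ℕ} (σ : Equiv.Perm (Fin m)) : Prop :=
  ∀ (i : ℕ) (h : i + 1 < m),
    (Even i → σ ⟨i, Nat.lt_of_succ_lt h⟩ < σ ⟨i + 1, h⟩) ∧
    (Odd i → σ ⟨i + 1, h⟩ < σ ⟨i, Nat.lt_of_succ_lt h⟩)

/-- The tangent number `T m`: the number of up-down alternating permutations of `Fin m`. -/
noncomputable def tangentNumber (m : ℕ) : ℕ :=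
  Nat.card {σ : Equiv.Perm (Fin m) // IsUpDown σ}

open Finset PowerSeries

/-! ### Excedances: the Eulerian recurrence -/

lemma exc_le {n : ℕ} (σ : Equiv.Perm (Fin n)) : exc σ ≤ n := by
  unfold exc
  exact (Finset.card_le_univ _).trans (by simp)

lemma exc_eq_sum {n : ℕ} (σ : Equiv.Perm (Fin n)) :
    exc σ = ∑ i, if i < σ i then 1 else 0 := by
  simp [exc]

lemma exc_decompose_zero {n : ℕ} (τ : Equiv.Perm (Fin n)) :
    exc (Equiv.Perm.decomposeFin.symm (0, τ)) = exc τ := by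
  rw [exc_eq_sum, exc_eq_sum, Fin.sum_univ_succ]
  simp

lemma exc_decompose_succ {n : ℕ} (τ : Equiv.Perm (Fin n)) (j : Fin n) :
    exc (Equiv.Perm.decomposeFin.symm ((τ j).succ, τ)) =
      if j < τ j then exc τ else exc τ + 1 := by
  have h1 : exc (Equiv.Perm.decomposeFin.symm ((τ j).succ, τ)) =
      1 + ∑ i, if i = j then 0 else (if i < τ i then 1 else 0) := by
    rw [exc_eq_sum, Fin.sum_univ_succ]
    refine congrArg₂ (· + ·) ?_ ?_
    · simp
    · refine Finset.sum_congr rfl fun i _ => ?_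
      rw [Equiv.Perm.decomposeFin_symm_apply_succ]
      by_cases h : i = j
      · subst h; simp
      · rw [Equiv.swap_apply_of_ne_of_ne (Fin.succ_ne_zero _) (by simpa using h)]
        simp [h]
  have h2 : exc τ = (if j < τ j then 1 else 0) +
      ∑ i, if i = j then 0 else (if i < τ i then 1 else 0) := by
    rw [exc_eq_sum, ← Finset.add_sum_erase _ _ (Finset.mem_univ j)]
    congr 1
    rw [← Finset.add_sum_erase (Finset.univ) (fun i => if i = j then 0 else _) (Finset.mem_univ j)]
    simp only [if_true, zero_add]
    refine Finset.sum_congr rfl fun i hi => ?_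
    simp [Finset.ne_of_mem_erase hi]
  rw [h1]
  split_ifs at h2 ⊢ <;> omega

lemma sum_exc_succ {M : Type*} [AddCommMonoid M] (n : ℕ) (f : ℕ → M) :
    ∑ σ : Equiv.Perm (Fin (n + 1)), f (exc σ) =
      ∑ τ : Equiv.Perm (Fin n), ((exc τ + 1) • f (exc τ) + (n - exc τ) • f (exc τ + 1)) := by
  rw [← Equiv.sum_comp (Equiv.Perm.decomposeFin (n := n)).symm, Fintype.sum_prod_type_right]
  refine Finset.sum_congr rfl fun τ _ => ?_
  rw [Fin.sum_univ_succ, exc_decompose_zero, ← Equiv.sum_comp τ]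
  simp only [exc_decompose_succ]
  have h : ∀ j, f (if j < τ j then exc τ else exc τ + 1) =
      if j < τ j then f (exc τ) else f (exc τ + 1) := fun j => by split_ifs <;> rfl
  simp only [h]
  rw [Finset.sum_ite, Finset.sum_const, Finset.sum_const, succ_nsmul', add_assoc]
  have hc : (Finset.univ.filter fun j : Fin n => ¬ j < τ j).card = n - exc τ := by
    have := Finset.card_filter_add_card_filter_not (s := (Finset.univ : Finset (Fin n)))
      (fun j => j < τ j)
    simp only [Finset.card_univ, Fintype.card_fin] at this
    unfold exc
    omega
  rw [hc]
  rfl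

/-! ### Power series -/

namespace TanAux

local notation "d" => (PowerSeries.derivative ℂ)

noncomputable def co : PowerSeries ℂ := PowerSeries.cos ℂ
noncomputable def si : PowerSeries ℂ := PowerSeries.sin ℂ
noncomputable def se : PowerSeries ℂ := co⁻¹
noncomputable def ta : PowerSeries ℂ := si * se

lemma d_si : d si = co := by
  ext n
  rw [coeff_derivative]
  simp only [si, co, PowerSeries.sin, PowerSeries.cos, coeff_mk]
  by_cases h : Even n
  · have h' : ¬ Even (n + 1) := by simpa [Nat.even_add_one] using h
    obtain ⟨k, rfl⟩ := h
    have e : (k + k + 1) / 2 = (k + k) / 2 := by omega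
    have : ((k + k : ℕ) : ℂ) + 1 ≠ 0 := by exact_mod_cast Nat.succ_ne_zero (k + k)
    have h3 : ((k + k).factorial : ℂ) ≠ 0 := by exact_mod_cast Nat.factorial_ne_zero _
    simp only [h', if_false, e, Nat.factorial_succ]
    push_cast at *
    rw [← two_mul] at this
    simp
    field_simp
    ring_nf at this ⊢
    linear_combination mul_inv_cancel₀ this
  · have h' : Even (n + 1) := by simpa [Nat.even_add_one] using h
    simp [h, h']

lemma d_co : d co = -si := by
  ext n
  rw [coeff_derivative]
  simp only [si, co, PowerSeries.sin, PowerSeries.cos, coeff_mk, map_neg]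
  by_cases h : Even n
  · have h' : ¬ Even (n + 1) := by simpa [Nat.even_add_one] using h
    simp [h, h']
  · have h' : Even (n + 1) := by simpa [Nat.even_add_one] using h
    simp only [h, h', if_true, if_false]
    obtain ⟨k, rfl⟩ := Nat.not_even_iff_odd.mp h
    have e : (2 * k + 1 + 1) / 2 = k + 1 := by omega
    have e2 : (2 * k + 1) / 2 = k := by omega
    have : ((2 * k + 1 : ℕ) : ℂ) + 1 ≠ 0 := by exact_mod_cast Nat.succ_ne_zero (2 * k + 1)
    have h3 : ((2 * k + 1).factorial : ℂ) ≠ 0 := by exact_mod_cast Nat.factorial_ne_zero _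
    rw [e, e2, Nat.factorial_succ (2 * k + 1)]
    push_cast at *
    simp
    field_simp
    ring

lemma c_co : constantCoeff co = 1 := by
  rw [← coeff_zero_eq_constantCoeff_apply]
  simp [co, PowerSeries.cos]

lemma c_si : constantCoeff si = 0 := by
  rw [← coeff_zero_eq_constantCoeff_apply]
  simp [si, PowerSeries.sin]

lemma co_se : co * se = 1 := PowerSeries.mul_inv_cancel _ (by simp [c_co])

lemma c_ta : constantCoeff ta = 0 := by simp [ta, c_si]

lemma d_se : d se = se * ta := by
  rw [se, derivative_inv', d_co, ← se, ta]
  ring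

lemma d_ta : d ta = 1 + ta ^ 2 := by
  have : d ta = si * d se + se * d si := by
    rw [ta, Derivation.leibniz]; rfl
  rw [this, d_se, d_si, ← co_se, ta]
  ring

lemma coeff_se_odd (n : ℕ) (hn : Odd n) : constantCoeff (d^[n] se) = 0 := by
  have h1 : rescale (-1 : ℂ) co = co := by
    ext m
    rw [coeff_rescale]
    simp only [co, PowerSeries.cos, coeff_mk]
    by_cases h : Even m
    · simp [h, h.neg_one_pow]
    · simp [h]
  have h2 : rescale (-1 : ℂ) se = se := by
    have h3 : co * rescale (-1 : ℂ) se = 1 := by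
      rw [← h1, ← map_mul, co_se, map_one]
    calc rescale (-1 : ℂ) se = (co * se) * rescale (-1 : ℂ) se := by rw [co_se, one_mul]
      _ = se * (co * rescale (-1 : ℂ) se) := by ring
      _ = se := by rw [h3, mul_one]
  have h4 := congrArg (coeff n) h2
  rw [coeff_rescale, hn.neg_one_pow] at h4
  have h5 : coeff n se = 0 := by
    have : (2 : ℂ) * coeff n se = 0 := by linear_combination -h4
    simpa using this
  rw [constantCoeff_iterate_derivative, h5]
  simp

noncomputable def uu : PowerSeries ℂ := 1 - C Complex.I * ta
noncomputable def vv : PowerSeries ℂ := 1 + C Complex.I * ta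

lemma CI_sq : (C Complex.I : PowerSeries ℂ) * C Complex.I = -1 := by
  rw [← map_mul, Complex.I_mul_I]; simp

lemma d_C_mul (c : ℂ) (f : PowerSeries ℂ) : d (C c * f) = C c * d f := by
  rw [Derivation.leibniz]; simp

lemma d_uu : d uu = - C Complex.I * (uu * vv) := by
  have : d uu = - (C Complex.I * d ta) := by
    rw [uu, map_sub, d_C_mul]; simp
  rw [this, d_ta, uu, vv]
  linear_combination (-(C Complex.I) * ta ^ 2) * CI_sq

lemma d_vv : d vv = C Complex.I * (uu * vv) := by
  have : d vv = (C Complex.I * d ta) := by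
    rw [vv, map_add, d_C_mul]; simp
  rw [this, d_ta, uu, vv]
  linear_combination ((C Complex.I) * ta ^ 2) * CI_sq

lemma d_pow (f : PowerSeries ℂ) (a : ℕ) : f * d (f ^ a) = a * f ^ a * d f := by
  rcases a with _ | a
  · simp
  · rw [PowerSeries.derivative_pow]; simp; ring

lemma d_term (a b : ℕ) : - C Complex.I * d (uu ^ a * vv ^ b) =
    - (a * (uu ^ a * vv ^ (b + 1))) + b * (uu ^ (a + 1) * vv ^ b) := by
  have hu : d (uu ^ a) = - C Complex.I * a * uu ^ a * vv := by
    rcases a with _ | a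
    · simp
    · rw [PowerSeries.derivative_pow, d_uu]; simp; ring
  have hv : d (vv ^ b) = C Complex.I * b * vv ^ b * uu := by
    rcases b with _ | b
    · simp
    · rw [PowerSeries.derivative_pow, d_vv]; simp; ring
  have : d (uu ^ a * vv ^ b) = uu ^ a * d (vv ^ b) + vv ^ b * d (uu ^ a) := by
    rw [Derivation.leibniz]; rfl
  rw [this, hu, hv]
  linear_combination ((a : PowerSeries ℂ) * uu ^ a * vv ^ (b + 1)
    - b * uu ^ (a + 1) * vv ^ b) * CI_sq

lemma exc_series (n : ℕ) :
    ∑ σ : Equiv.Perm (Fin n), (-1 : PowerSeries ℂ) ^ (n - exc σ) *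
      (uu ^ (exc σ + 1) * vv ^ (n - exc σ)) = (- C Complex.I) ^ n * d^[n] uu := by
  induction n with
  | zero => simp [exc]
  | succ n ih =>
    rw [sum_exc_succ n (fun e => (-1 : PowerSeries ℂ) ^ (n + 1 - e) *
      (uu ^ (e + 1) * vv ^ (n + 1 - e)))]
    have h : (- C Complex.I) ^ (n + 1) * d^[n + 1] uu =
        - C Complex.I * d ((- C Complex.I) ^ n * d^[n] uu) := by
      rw [Function.iterate_succ_apply', ← map_neg, ← map_pow, ← map_pow, d_C_mul, pow_succ, map_mul]
      ring
    rw [h, ← ih, map_sum, Finset.mul_sum]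
    refine Finset.sum_congr rfl fun τ _ => ?_
    have hle := exc_le τ
    obtain ⟨b, hb⟩ := Nat.exists_eq_add_of_le hle
    generalize exc τ = e at *
    subst hb
    have e1 : e + b - e = b := by omega
    have e2 : e + b + 1 - e = b + 1 := by omega
    have e3 : e + b + 1 - (e + 1) = b := by omega
    simp only [e1, e2, e3]
    have hs : ((-1 : PowerSeries ℂ)) ^ b = C ((-1) ^ b) := by simp
    rw [pow_succ (-1 : PowerSeries ℂ) b, hs, d_C_mul, mul_left_comm (- C Complex.I), d_term]
    simp only [nsmul_eq_mul]
    push_cast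
    ring

lemma S_eq (n : ℕ) (hn : 1 ≤ n) :
    (S (2 * n - 1) : ℂ) = (-1) ^ (n - 1) * constantCoeff (d^[2 * n - 1] ta) := by
  obtain ⟨k, rfl⟩ : ∃ k, n = k + 1 := ⟨n - 1, by omega⟩
  have e : 2 * (k + 1) - 1 = 2 * k + 1 := by omega
  rw [e, Nat.add_sub_cancel]
  have h := congrArg (constantCoeff (R := ℂ)) (exc_series (2 * k + 1))
  have hu : constantCoeff uu = 1 := by simp [uu, c_ta]
  have hv : constantCoeff vv = 1 := by simp [vv, c_ta]
  have hd : d^[2 * k + 1] uu = - C Complex.I * d^[2 * k + 1] ta := by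
    have : ∀ m, d^[m + 1] uu = - C Complex.I * d^[m + 1] ta := by
      intro m
      induction m with
      | zero =>
        simp only [zero_add, Function.iterate_one]
        rw [uu, map_sub, d_C_mul]; simp
      | succ m ih =>
        rw [Function.iterate_succ_apply', ih, ← map_neg, d_C_mul, ← Function.iterate_succ_apply' d]
    exact this _
  rw [hd] at h
  simp only [map_sum, map_mul, map_pow, map_neg, map_one, hu, hv, one_pow, mul_one,
    constantCoeff_C] at h
  have hS : ∑ σ : Equiv.Perm (Fin (2 * k + 1)), (-1 : ℂ) ^ (2 * k + 1 - exc σ) =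
      - (S (2 * k + 1) : ℂ) := by
    unfold S
    push_cast
    rw [← Finset.sum_neg_distrib]
    refine Finset.sum_congr rfl fun σ _ => ?_
    obtain ⟨b, hb⟩ := Nat.exists_eq_add_of_le (exc_le σ)
    have : (-1 : ℂ) ^ (exc σ + b) = -1 := by rw [← hb]; simp [pow_succ]
    rw [pow_add] at this
    have e1 : 2 * k + 1 - exc σ = b := by omega
    rw [e1]
    have h2 : (-1 : ℂ) ^ exc σ * (-1) ^ exc σ = 1 := by rw [← mul_pow]; simp
    linear_combination (-1 : ℂ) ^ exc σ * this - (-1) ^ b * h2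
  rw [hS] at h
  have hI : (-Complex.I) ^ (2 * k + 1) = (-1) ^ k * (-Complex.I) := by
    rw [pow_succ, pow_mul]; simp
  rw [hI] at h
  linear_combination -h - (-1) ^ k * constantCoeff (d^[2 * k + 1] ta) * Complex.I_mul_I

/-- The Entringer numbers as derivatives. -/
noncomputable def Phi (a b : ℕ) : ℂ :=
  constantCoeff (d^[a] (co * d^[b] se)) + constantCoeff (d^[b] (si * d^[a] se))

lemma d_mul (f g : PowerSeries ℂ) : d (f * g) = f * d g + g * d f := by
  rw [Derivation.leibniz]; rfl

lemma iter_add (n : ℕ) (f g : PowerSeries ℂ) : d^[n] (f + g) = d^[n] f + d^[n] g :=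
  iterate_map_add d n f g

lemma Phi_rec (a b : ℕ) : Phi a (b + 1) = Phi (a + 1) b + Phi b a := by
  unfold Phi
  have h1 : d^[a + 1] (co * d^[b] se) =
      d^[a] (co * d^[b + 1] se) - d^[a] (si * d^[b] se) := by
    rw [Function.iterate_succ_apply, d_mul, d_co, ← Function.iterate_succ_apply' d,
      ← iterate_map_sub]
    congr 1; ring
  have h2 : d^[b + 1] (si * d^[a] se) =
      d^[b] (si * d^[a + 1] se) + d^[b] (co * d^[a] se) := by
    rw [Function.iterate_succ_apply, d_mul, d_si, ← Function.iterate_succ_apply' d,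
      ← iterate_map_add]
    congr 1; ring
  rw [h1, h2]
  simp only [map_add, map_sub]
  ring

lemma Phi_succ_zero (a : ℕ) : Phi (a + 1) 0 = 0 := by
  unfold Phi
  simp only [Function.iterate_zero, id, co_se, map_mul, c_si, zero_mul, add_zero]
  rw [Function.iterate_succ_apply, derivative_one, iterate_map_zero, map_zero]

lemma Phi_zero_zero : Phi 0 0 = 1 := by
  unfold Phi
  simp [co_se, c_si]

lemma Phi_zero_odd (n : ℕ) (hn : Odd n) : Phi 0 n = constantCoeff (d^[n] ta) := by
  unfold Phi
  simp only [Function.iterate_zero, id, map_mul, coeff_se_odd n hn, mul_zero, zero_add, ta]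

end TanAux

/-! ### Alternating permutations -/

namespace AltAux

def IsDownUp {m : ℕ} (σ : Equiv.Perm (Fin m)) : Prop :=
  ∀ (i : ℕ) (h : i + 1 < m),
    (Even i → σ ⟨i + 1, h⟩ < σ ⟨i, Nat.lt_of_succ_lt h⟩) ∧
    (Odd i → σ ⟨i, Nat.lt_of_succ_lt h⟩ < σ ⟨i + 1, h⟩)

lemma isDownUp_rev {m : ℕ} (σ : Equiv.Perm (Fin m)) :
    IsDownUp (σ.trans Fin.revPerm) ↔ IsUpDown σ := by
  simp [IsDownUp, IsUpDown]

/-- Prepend the value `p`. -/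
noncomputable def ins {n : ℕ} (p : Fin (n + 1)) (τ : Equiv.Perm (Fin n)) :
    Equiv.Perm (Fin (n + 1)) :=
  Equiv.ofBijective (Fin.cons p (fun i => p.succAbove (τ i)) : Fin (n + 1) → Fin (n + 1))
    (Finite.injective_iff_bijective.mp (by
      rw [Fin.cons_injective_iff]
      refine ⟨?_, ?_⟩
      · rintro ⟨i, hi⟩
        exact Fin.succAbove_ne _ _ hi
      · exact Fin.succAbove_right_injective.comp τ.injective))

lemma ins_zero {n : ℕ} (p : Fin (n + 1)) (τ : Equiv.Perm (Fin n)) : ins p τ 0 = p := rfl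

lemma ins_succ {n : ℕ} (p : Fin (n + 1)) (τ : Equiv.Perm (Fin n)) (i : Fin n) :
    ins p τ i.succ = p.succAbove (τ i) := rfl

lemma ins_injective {n : ℕ} (p : Fin (n + 1)) : Function.Injective (ins p) := by
  intro τ τ' h
  ext i
  have := congrArg (fun s => s i.succ) h
  simp only [ins_succ] at this
  rw [Fin.succAbove_right_injective this]

lemma ins_surj {n : ℕ} (σ : Equiv.Perm (Fin (n + 1))) : ∃ τ, ins (σ 0) τ = σ := by
  have h : ∀ i : Fin n, ∃ j, (σ 0).succAbove j = σ i.succ := fun i =>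
    Fin.exists_succAbove_eq (fun h => Fin.succ_ne_zero i (σ.injective h))
  choose f hf using h
  have hinj : Function.Injective f := by
    intro i j hij
    have : σ i.succ = σ j.succ := by rw [← hf, ← hf, hij]
    exact Fin.succ_injective _ (σ.injective this)
  refine ⟨Equiv.ofBijective f (Finite.injective_iff_bijective.mp hinj), ?_⟩
  ext i
  refine Fin.cases ?_ (fun j => ?_) i
  · rw [ins_zero]
  · rw [ins_succ, ← hf]; rfl

lemma isUpDown_ins {n : ℕ} (p : Fin (n + 2)) (τ : Equiv.Perm (Fin (n + 1))) :
    IsUpDown (ins p τ) ↔ p ≤ (τ 0).castSucc ∧ IsDownUp τ := by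
  rw [← Fin.lt_succAbove_iff_le_castSucc]
  constructor
  · intro h
    have h0 := (h 0 (by omega)).1 (by simp)
    have e0 : ins p τ ⟨0 + 1, by omega⟩ = p.succAbove (τ 0) := rfl
    rw [e0] at h0
    refine ⟨h0, fun i hi => ?_⟩
    have := h (i + 1) (by omega)
    have e1 : ins p τ ⟨i + 1, by omega⟩ = p.succAbove (τ ⟨i, by omega⟩) := rfl
    have e2 : ins p τ ⟨i + 1 + 1, by omega⟩ = p.succAbove (τ ⟨i + 1, hi⟩) := rfl
    rw [e1, e2, Fin.succAbove_lt_succAbove_iff, Fin.succAbove_lt_succAbove_iff,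
      Nat.even_add_one, Nat.odd_add_one, Nat.not_even_iff_odd, Nat.not_odd_iff_even] at this
    exact ⟨this.2, this.1⟩
  · rintro ⟨h0, h⟩ i hi
    rcases i with _ | i
    · exact ⟨fun _ => h0, fun h => by simp at h⟩
    · have := h i (by omega)
      have e1 : ins p τ ⟨i + 1, by omega⟩ = p.succAbove (τ ⟨i, by omega⟩) := rfl
      have e2 : ins p τ ⟨i + 1 + 1, by omega⟩ = p.succAbove (τ ⟨i + 1, by omega⟩) := rfl
      rw [e1, e2, Fin.succAbove_lt_succAbove_iff, Fin.succAbove_lt_succAbove_iff,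
        Nat.even_add_one, Nat.odd_add_one, Nat.not_even_iff_odd, Nat.not_odd_iff_even]
      exact ⟨this.2, this.1⟩

open Classical in
/-- Number of up-down permutations with first value `k`. -/
noncomputable def ent (n : ℕ) (k : Fin (n + 1)) : ℕ :=
  (Finset.univ.filter fun σ : Equiv.Perm (Fin (n + 1)) => IsUpDown σ ∧ σ 0 = k).card

open Classical in
lemma ent_succ (n : ℕ) (k : Fin (n + 2)) : ent (n + 1) k =
    (Finset.univ.filter fun τ : Equiv.Perm (Fin (n + 1)) =>
      k ≤ (τ 0).castSucc ∧ IsDownUp τ).card := by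
  symm
  refine Finset.card_bij (fun τ _ => ins k τ) ?_ ?_ ?_
  · intro τ hτ
    simp only [Finset.mem_filter, Finset.mem_univ, true_and] at hτ ⊢
    exact ⟨(isUpDown_ins k τ).2 hτ, ins_zero _ _⟩
  · intro τ _ τ' _ h
    exact ins_injective k h
  · intro σ hσ
    simp only [Finset.mem_filter, Finset.mem_univ, true_and] at hσ
    obtain ⟨τ, hτ⟩ := ins_surj σ
    rw [hσ.2] at hτ
    refine ⟨τ, ?_, hτ⟩
    simp only [Finset.mem_filter, Finset.mem_univ, true_and]
    rw [← isUpDown_ins, hτ]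
    exact hσ.1

open Classical in
lemma ent_rev (n : ℕ) (k : Fin (n + 1)) : ent n k.rev =
    (Finset.univ.filter fun τ : Equiv.Perm (Fin (n + 1)) => τ 0 = k ∧ IsDownUp τ).card := by
  refine Finset.card_bij (fun σ _ => σ.trans Fin.revPerm) ?_ ?_ ?_
  · intro σ hσ
    simp only [Finset.mem_filter, Finset.mem_univ, true_and] at hσ ⊢
    exact ⟨by rw [Equiv.trans_apply, hσ.2]; simp, (isDownUp_rev σ).2 hσ.1⟩
  · intro σ _ σ' _ h
    ext i
    have := congrArg (fun s => s i) h
    simp at this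
    rw [this]
  · intro τ hτ
    simp only [Finset.mem_filter, Finset.mem_univ, true_and] at hτ
    have e : (τ.trans Fin.revPerm).trans Fin.revPerm = τ := by ext i; simp
    refine ⟨τ.trans Fin.revPerm, ?_, e⟩
    simp only [Finset.mem_filter, Finset.mem_univ, true_and]
    refine ⟨?_, by simp [hτ.1]⟩
    rw [← isDownUp_rev, e]
    exact hτ.2

lemma ent_last (n : ℕ) : ent (n + 1) (Fin.last _) = 0 := by
  classical
  rw [ent_succ, Finset.card_eq_zero, Finset.filter_eq_empty_iff]
  rintro τ - ⟨h, -⟩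
  exact absurd h (not_le.mpr (Fin.castSucc_lt_last _))

lemma ent_step (n : ℕ) (j : Fin (n + 1)) :
    ent (n + 1) j.castSucc = ent (n + 1) j.succ + ent n j.rev := by
  classical
  rw [ent_succ, ent_succ, ent_rev, ← Finset.card_union_of_disjoint]
  · congr 1
    ext τ
    simp only [Finset.mem_filter, Finset.mem_univ, true_and, Finset.mem_union,
      Fin.castSucc_le_castSucc_iff, Fin.succ_le_castSucc_iff]
    rw [le_iff_lt_or_eq, or_and_right, eq_comm (a := j)]
  · rw [Finset.disjoint_left]
    intro τ h1 h2
    simp only [Finset.mem_filter, Finset.mem_univ, true_and, Fin.succ_le_castSucc_iff] at h1 h2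
    exact absurd h2.1 (ne_of_gt h1.1)

lemma ent_zero : ent 0 0 = 1 := by
  classical
  unfold ent
  rw [Finset.card_eq_one]
  refine ⟨1, ?_⟩
  ext σ
  simp only [Finset.mem_filter, Finset.mem_univ, true_and, Finset.mem_singleton]
  refine ⟨fun _ => by ext i; omega, fun _ => ⟨fun i h => by omega, by ext; omega⟩⟩

lemma ent_eq (n : ℕ) (k : Fin (n + 1)) : (ent n k : ℂ) = TanAux.Phi k (n - k) := by
  induction n with
  | zero =>
    obtain rfl : k = 0 := by ext; have := k.isLt; simp only [Fin.val_zero]; omega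
    rw [ent_zero]; simp [TanAux.Phi_zero_zero]
  | succ n ih =>
    induction k using Fin.reverseInduction with
    | last => rw [ent_last]; simp [TanAux.Phi_succ_zero]
    | cast j ihj =>
      rw [ent_step]
      push_cast
      rw [ihj, ih]
      have hj : (j : ℕ) ≤ n := by omega
      have e1 : n + 1 - (j : ℕ) = n - j + 1 := by omega
      have e2 : n - (n - (j : ℕ)) = j := by omega
      have e3 : (j.rev : ℕ) = n - j := by rw [Fin.val_rev]; omega
      rw [e3, e2]
      simp only [Fin.val_castSucc, Fin.val_succ, e1, Nat.add_sub_add_right]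
      rw [TanAux.Phi_rec]

lemma tangent_eq (n : ℕ) : tangentNumber (n + 1) = ent (n + 1) 0 := by
  classical
  rw [ent_succ, tangentNumber, Nat.card_eq_fintype_card, Fintype.card_subtype]
  refine Finset.card_bij (fun σ _ => σ.trans Fin.revPerm) ?_ ?_ ?_
  · intro σ hσ
    simp only [Finset.mem_filter, Finset.mem_univ, true_and] at hσ ⊢
    exact ⟨Fin.zero_le _, (isDownUp_rev σ).2 hσ⟩
  · intro σ _ σ' _ h
    ext i
    have := congrArg (fun s => s i) h
    simp at this
    rw [this]
  · intro τ hτ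
    simp only [Finset.mem_filter, Finset.mem_univ, true_and] at hτ
    have e : (τ.trans Fin.revPerm).trans Fin.revPerm = τ := by ext i; simp
    refine ⟨τ.trans Fin.revPerm, ?_, e⟩
    simp only [Finset.mem_filter, Finset.mem_univ, true_and]
    rw [← isDownUp_rev, e]
    exact hτ.2

end AltAux

theorem alternating_sum_excedances_eq_signed_tangent (n : ℕ) (hn : 1 ≤ n) :
    S (2 * n - 1) = (-1 : ℤ) ^ (n - 1) * tangentNumber (2 * n - 1) := by
  have h1 := TanAux.S_eq n hn
  have e : 2 * n - 1 = 2 * (n - 1) + 1 := by omega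
  have h2 : (tangentNumber (2 * n - 1) : ℂ) =
      PowerSeries.constantCoeff ((PowerSeries.derivative ℂ)^[2 * n - 1] TanAux.ta) := by
    rw [e, AltAux.tangent_eq, AltAux.ent_eq, ← TanAux.Phi_zero_odd _ ⟨n - 1, rfl⟩]
    simp
  rw [← h2] at h1
  exact_mod_cast h1
end

section
/- For every integer n ≥ 1, the number of up-down alternating permutations of Fin (2n−1) equals (−1)^{n−1} · (2^{2n}·(2^{2n} − 1)/(2n)) · B_{2n}, as an identity of rational numbers, where B_{2n} is the (2n)-th Bernoulli number. -/
/-- Alternating permutations with a parity shift `p`. -/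
def TNAlt (p : ℕ) {m : ℕ} (σ : Equiv.Perm (Fin m)) : Prop :=
  ∀ (i : ℕ) (h : i + 1 < m),
    (Even (i + p) → σ ⟨i, Nat.lt_of_succ_lt h⟩ < σ ⟨i + 1, h⟩) ∧
    (Odd (i + p) → σ ⟨i + 1, h⟩ < σ ⟨i, Nat.lt_of_succ_lt h⟩)

theorem TNAlt_add_two (p : ℕ) {m : ℕ} (σ : Equiv.Perm (Fin m)) :
    TNAlt (p + 2) σ ↔ TNAlt p σ := by
  unfold TNAlt
  have h1 : ∀ i, Even (i + (p + 2)) ↔ Even (i + p) := by intro i; grind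
  have h2 : ∀ i, Odd (i + (p + 2)) ↔ Odd (i + p) := by intro i; grind
  simp only [h1, h2]

/-- Insert a first value `k` in front of a permutation. -/
noncomputable def TNins {m : ℕ} (k : Fin (m + 1)) (τ : Equiv.Perm (Fin m)) :
    Equiv.Perm (Fin (m + 1)) :=
  Equiv.ofBijective (Fin.cons k (fun i => k.succAbove (τ i)) : Fin (m + 1) → Fin (m + 1)) (by
    rw [← Finite.injective_iff_bijective, Fin.cons_injective_iff]
    refine ⟨?_, fun a b h => ?_⟩
    · rintro ⟨i, hi⟩
      exact Fin.succAbove_ne _ _ hi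
    · exact τ.injective (Fin.succAbove_right_injective h))

theorem TNins_zero {m : ℕ} (k : Fin (m + 1)) (τ : Equiv.Perm (Fin m)) : TNins k τ 0 = k := rfl

theorem TNins_succ {m : ℕ} (k : Fin (m + 1)) (τ : Equiv.Perm (Fin m)) (i : Fin m) :
    TNins k τ i.succ = k.succAbove (τ i) := rfl

theorem TNins_surj {m : ℕ} (σ : Equiv.Perm (Fin (m + 1))) : ∃ τ, TNins (σ 0) τ = σ := by
  have h : ∀ i : Fin m, ∃ j, (σ 0).succAbove j = σ i.succ := by
    intro i
    apply Fin.exists_succAbove_eq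
    intro h
    exact Fin.succ_ne_zero i (σ.injective h)
  choose f hf using h
  have hinj : Function.Injective f := by
    intro a b hab
    have : σ a.succ = σ b.succ := by rw [← hf, ← hf, hab]
    exact Fin.succ_injective _ (σ.injective this)
  refine ⟨Equiv.ofBijective f (Finite.injective_iff_bijective.1 hinj), ?_⟩
  ext i
  refine Fin.cases ?_ (fun i => ?_) i
  · rfl
  · rw [TNins_succ]
    simp [hf]

theorem TNins_inj {m : ℕ} (k : Fin (m + 1)) : Function.Injective (TNins k) := by
  intro a b h
  ext i
  have := congrArg (fun s : Equiv.Perm (Fin (m + 1)) => s i.succ) h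
  simp only [TNins_succ] at this
  rw [Fin.succAbove_right_injective this]

theorem TNins_alt {m : ℕ} (p : ℕ) (k : Fin (m + 2)) (τ : Equiv.Perm (Fin (m + 1))) :
    TNAlt p (TNins k τ) ↔ TNAlt (p + 1) τ ∧ (Even p → k.val ≤ (τ 0).val) ∧
      (Odd p → (τ 0).val < k.val) := by
  have hs : ∀ (i : ℕ) (h : i + 1 < m + 2),
      TNins k τ ⟨i + 1, h⟩ = k.succAbove (τ ⟨i, by omega⟩) := fun i h => rfl
  have h0 : ∀ h, TNins k τ ⟨0, h⟩ = k := fun h => rfl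
  have lt0 : ∀ j : Fin (m + 1), k < k.succAbove j ↔ k.val ≤ j.val := by
    intro j
    rw [Fin.lt_succAbove_iff_le_castSucc, Fin.le_def]; rfl
  have gt0 : ∀ j : Fin (m + 1), k.succAbove j < k ↔ j.val < k.val := by
    intro j
    rw [Fin.succAbove_lt_iff_castSucc_lt, Fin.lt_def]; rfl
  constructor
  · intro H
    refine ⟨fun i hi => ?_, ?_, ?_⟩
    · have := H (i + 1) (by omega)
      rw [hs, hs, Fin.succAbove_lt_succAbove_iff, Fin.succAbove_lt_succAbove_iff] at this
      rw [show i + (p + 1) = i + 1 + p by ring]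
      exact this
    · intro hp
      have := (H 0 (by omega)).1 (by simpa using hp)
      rw [hs, h0, lt0] at this
      exact this
    · intro hp
      have := (H 0 (by omega)).2 (by simpa using hp)
      rw [hs, h0, gt0] at this
      exact this
  · rintro ⟨H, H1, H2⟩ i hi
    rcases i with _ | i
    · rw [hs, h0, lt0, gt0]
      simpa using ⟨H1, H2⟩
    · rw [hs, hs, Fin.succAbove_lt_succAbove_iff, Fin.succAbove_lt_succAbove_iff]
      rw [show i + 1 + p = i + (p + 1) by ring]
      exact H i (by omega)

/-- Number of alternating permutations with given parity whose first value satisfies `C`. -/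
noncomputable def TNcnt (p m : ℕ) (C : ℕ → Prop) : ℕ :=
  Nat.card {σ : Equiv.Perm (Fin (m + 1)) // TNAlt p σ ∧ C (σ 0).val}

theorem TNcnt_congr (p m : ℕ) (C D : ℕ → Prop) (h : ∀ j, j ≤ m → (C j ↔ D j)) :
    TNcnt p m C = TNcnt p m D := by
  unfold TNcnt
  refine Nat.card_congr (Equiv.subtypeEquivRight fun σ => ?_)
  rw [h _ (by have := (σ 0).isLt; omega)]

theorem TNcnt_false (p m : ℕ) (C : ℕ → Prop) (h : ∀ j, j ≤ m → ¬ C j) : TNcnt p m C = 0 := by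
  rw [TNcnt_congr p m C (fun _ => False) (by simpa using h)]
  simp [TNcnt]

theorem TNcnt_add_two (p m : ℕ) (C : ℕ → Prop) : TNcnt (p + 2) m C = TNcnt p m C := by
  simp only [TNcnt, TNAlt_add_two]

theorem TNcnt_split (p m : ℕ) (C D E : ℕ → Prop) (h : ∀ j, C j ↔ D j ∨ E j)
    (hd : ∀ j, D j → ¬ E j) : TNcnt p m C = TNcnt p m D + TNcnt p m E := by
  classical
  simp only [TNcnt, Nat.card_eq_fintype_card, Fintype.card_subtype]
  rw [← Finset.card_union_of_disjoint]
  · congr 1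
    ext σ
    simp only [Finset.mem_filter, Finset.mem_univ, true_and, Finset.mem_union, h]
    tauto
  · rw [Finset.disjoint_filter]
    intro σ _ h1 h2
    exact hd _ h1.2 h2.2

theorem TNcnt_rec (p m k : ℕ) (hk : k ≤ m + 1) : TNcnt p (m + 1) (fun j => j = k) =
    TNcnt (p + 1) m (fun j => (Even p → k ≤ j) ∧ (Odd p → j < k)) := by
  unfold TNcnt
  symm
  refine Nat.card_congr (Equiv.ofBijective
    (fun τ => ⟨TNins ⟨k, by omega⟩ τ.1, (TNins_alt _ _ _).2 τ.2, rfl⟩) ⟨?_, ?_⟩)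
  · intro a b h
    exact Subtype.ext (TNins_inj _ (congrArg Subtype.val h))
  · rintro ⟨σ, h1, h2⟩
    obtain ⟨τ, hτ⟩ := TNins_surj σ
    have hk' : σ 0 = ⟨k, by omega⟩ := Fin.ext h2
    rw [hk'] at hτ
    rw [← hτ] at h1
    exact ⟨⟨τ, (TNins_alt _ _ _).1 h1⟩, Subtype.ext hτ⟩

/-- Seidel matrix. -/
noncomputable def TNa (i j : ℕ) : ℚ :=
  (-1) ^ ((i + j + 1) / 2) * (TNcnt (i + j) (i + j) (fun v => v = i) : ℚ)

theorem TNa_rec (i j : ℕ) : TNa i (j + 1) = TNa i j + TNa (i + 1) j := by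
  unfold TNa
  obtain ⟨m, hm⟩ : ∃ m, i + j = m := ⟨_, rfl⟩
  rw [show i + (j + 1) = m + 1 by omega, show i + 1 + j = m + 1 by omega, hm,
    TNcnt_rec _ _ _ (by omega), TNcnt_rec _ _ _ (by omega), TNcnt_add_two, TNcnt_add_two]
  rcases Nat.even_or_odd m with he | ho
  · have ho : Odd (m + 1) := by grind
    have he' : ¬ Even (m + 1) := by grind
    simp only [ho, he', false_imp_iff, true_imp_iff, true_and]
    rw [TNcnt_split m m (fun j => j < i + 1) (fun j => j < i) (fun j => j = i)
      (by intro j; omega) (by intro j; omega)]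
    obtain ⟨t, rfl⟩ := he
    rw [show (t + t + 1 + 1) / 2 = t + 1 by omega, show (t + t + 1) / 2 = t by omega]
    push_cast
    ring
  · have he : Even (m + 1) := by grind
    have ho' : ¬ Odd (m + 1) := by grind
    simp only [he, ho', false_imp_iff, true_imp_iff, and_true]
    rw [TNcnt_split m m (fun j => i ≤ j) (fun j => i + 1 ≤ j) (fun j => j = i)
      (by intro j; omega) (by intro j; omega)]
    obtain ⟨t, rfl⟩ := ho
    rw [show (2 * t + 1 + 1 + 1) / 2 = t + 1 by omega, show (2 * t + 1 + 1) / 2 = t + 1 by omega]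
    push_cast
    ring

theorem TNa_sum (n : ℕ) : ∀ i, TNa i n = ∑ k ∈ Finset.range (n + 1), (n.choose k : ℚ) * TNa (i + k) 0 := by
  induction n with
  | zero => intro i; simp
  | succ n ih =>
    intro i
    rw [TNa_rec, ih, ih, Finset.sum_range_succ' _ (n + 1)]
    simp only [Nat.choose_succ_succ, Nat.cast_add, add_mul, Finset.sum_add_distrib]
    rw [Finset.sum_range_succ' _ n]
    have : ∑ x ∈ Finset.range (n + 1), ((n.choose (x + 1) : ℕ) : ℚ) * TNa (i + (x + 1)) 0
      = ∑ x ∈ Finset.range n, ((n.choose (x + 1) : ℕ) : ℚ) * TNa (i + (x + 1)) 0 := by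
      rw [Finset.sum_range_succ]; simp
    rw [this]
    have e : ∀ x, i + 1 + x = i + (x + 1) := fun x => by ring
    simp only [Nat.choose_zero_right, e]
    ring

theorem TNa_zero_zero : TNa 0 0 = 1 := by
  have : TNcnt 0 0 (fun v => v = 0) = 1 := by
    unfold TNcnt
    rw [Nat.card_eq_one_iff_unique]
    refine ⟨⟨fun a b => Subtype.ext (Equiv.ext fun x => Subsingleton.elim (α := Fin 1) _ _)⟩, ⟨⟨1, ?_, ?_⟩⟩⟩
    · intro i h; omega
    · simp
  simp [TNa, this]

theorem TNa_row (n : ℕ) (h : Odd n) : TNa 0 n = 0 := by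
  obtain ⟨t, rfl⟩ := h
  unfold TNa
  rw [show 0 + (2 * t + 1) = 2 * t + 1 by ring, TNcnt_rec _ _ _ (by omega),
    TNcnt_false]
  · simp
  · intro j _ h
    have := h.2 ⟨t, rfl⟩
    omega

theorem TNa_col (n : ℕ) (h : Even n) (h0 : n ≠ 0) : TNa n 0 = 0 := by
  obtain ⟨t, rfl⟩ := h
  obtain ⟨s, hs⟩ : ∃ s, t + t = s + 1 := ⟨t + t - 1, by omega⟩
  have he : Even (s + 1) := ⟨t, hs.symm⟩
  unfold TNa
  rw [hs, add_zero, TNcnt_rec _ _ _ (by omega), TNcnt_false]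
  · simp
  · intro j _ h
    have := h.1 he
    omega

theorem TNa_col_odd (t : ℕ) : TNa (2 * t + 1) 0 = (-1) ^ (t + 1) * (tangentNumber (2 * t + 1) : ℚ) := by
  unfold TNa
  rw [add_zero, TNcnt_rec _ _ _ (by omega), show (2 * t + 1 + 1) / 2 = t + 1 by omega]
  congr 2
  unfold TNcnt tangentNumber
  refine Nat.card_congr (Equiv.subtypeEquivRight fun σ => ?_)
  rw [TNAlt_add_two]
  have h1 : ∀ i, Even (i + 2 * t) ↔ Even i := by intro i; grind
  have h2 : ∀ i, Odd (i + 2 * t) ↔ Odd i := by intro i; grind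
  have ho' : ¬ Even (2 * t + 1) := by grind
  have := (σ 0).isLt
  simp only [TNAlt, IsUpDown, h1, h2, ho', false_imp_iff, true_and]
  exact ⟨fun h => h.1, fun h => ⟨h, fun _ => this⟩⟩

open PowerSeries in
theorem TN_key : (X : PowerSeries ℚ) * mk (fun i => TNa i 0 / (i.factorial : ℚ)) =
    rescale 2 (bernoulliPowerSeries ℚ) - rescale 4 (bernoulliPowerSeries ℚ) := by
  set A : PowerSeries ℚ := mk (fun i => TNa i 0 / (i.factorial : ℚ)) with hA
  set N := rescale (-1 : ℚ) with hN
  have hA2 : A + N A = 2 := by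
    ext n
    rw [show (2 : PowerSeries ℚ) = C 2 from (map_ofNat C 2).symm, coeff_C]
    simp only [map_add, hA, hN, coeff_rescale, coeff_mk]
    rcases Nat.even_or_odd n with h | h
    · rw [h.neg_one_pow]
      split_ifs with h0
      · subst h0; simp [TNa_zero_zero]; norm_num
      · rw [TNa_col n h h0]; simp
    · rw [h.neg_one_pow]
      have : n ≠ 0 := by rintro rfl; simp at h
      simp [this]
  have hR : exp ℚ * A = mk (fun n => TNa 0 n / (n.factorial : ℚ)) := by
    ext n
    rw [coeff_mul, Finset.Nat.sum_antidiagonal_eq_sum_range_succ_mk, ← Finset.sum_range_reflect,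
      coeff_mk, TNa_sum, Finset.sum_div]
    refine Finset.sum_congr rfl fun k hk => ?_
    have hk : k ≤ n := by simpa [Nat.lt_succ_iff] using hk
    rw [show n + 1 - 1 - k = n - k by omega, show n - (n - k) = k by omega, hA, coeff_mk, coeff_exp,
      Nat.cast_choose ℚ hk]
    have := Nat.factorial_ne_zero n
    have := Nat.factorial_ne_zero k
    have := Nat.factorial_ne_zero (n - k)
    simp only [map_div₀, map_one, map_natCast, zero_add]
    field_simp
  have hR2 : N (exp ℚ * A) = exp ℚ * A := by
    rw [hR]
    ext n
    simp only [hN, coeff_rescale, coeff_mk]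
    rcases Nat.even_or_odd n with h | h
    · rw [h.neg_one_pow]; simp
    · rw [TNa_row n h]; simp
  have hE : exp ℚ * N (exp ℚ) = 1 := by
    have := exp_mul_exp_neg_eq_one (A := ℚ)
    simpa [evalNegHom] using this
  have e2 : rescale 2 (exp ℚ) = exp ℚ ^ 2 := by
    rw [exp_pow_eq_rescale_exp]; simp
  have e4 : rescale 4 (exp ℚ) = exp ℚ ^ 4 := by
    rw [exp_pow_eq_rescale_exp]; simp
  have b := bernoulliPowerSeries_mul_exp_sub_one ℚ
  have b2 := congrArg (rescale (2 : ℚ)) b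
  have b4 := congrArg (rescale (4 : ℚ)) b
  simp only [map_mul, map_sub, map_one, e2, e4, rescale_X] at b2 b4
  rw [show (C (2 : ℚ)) = 2 from map_ofNat C 2] at b2
  rw [show (C (4 : ℚ)) = 4 from map_ofNat C 4] at b4
  rw [map_mul] at hR2
  have hne : exp ℚ ^ 4 - 1 ≠ 0 := by
    intro h
    rw [h, mul_zero] at b4
    have := congrArg (coeff 1) b4
    rw [show (4 : PowerSeries ℚ) = C 4 from (map_ofNat C 4).symm, coeff_C_mul] at this
    simp at this
  apply mul_right_cancel₀ hne
  have hmain : A * (exp ℚ ^ 2 + 1) = 2 := by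
    linear_combination (-exp ℚ) * hR2 + N A * hE + hA2
  linear_combination (X * (exp ℚ ^ 2 - 1)) * hmain - (exp ℚ ^ 2 + 1) * b2 + b4

theorem tangent_number_eq_bernoulli (n : ℕ) (hn : 1 ≤ n) :
    (tangentNumber (2 * n - 1) : ℚ) =
      (-1 : ℚ) ^ (n - 1) * (2 ^ (2 * n) * (2 ^ (2 * n) - 1) / (2 * n)) * bernoulli (2 * n) := by
  obtain ⟨t, rfl⟩ : ∃ t, n = t + 1 := ⟨n - 1, by omega⟩
  have h := congrArg (PowerSeries.coeff (2 * t + 1 + 1)) TN_key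
  rw [PowerSeries.coeff_succ_X_mul] at h
  simp only [map_sub, PowerSeries.coeff_rescale, PowerSeries.coeff_mk, bernoulliPowerSeries,
    TNa_col_odd] at h
  rw [show 2 * (t + 1) - 1 = 2 * t + 1 by omega, show t + 1 - 1 = t by omega]
  rw [show 2 * (t + 1) = 2 * t + 1 + 1 by ring]
  rw [Nat.factorial_succ (2 * t + 1)] at h
  have hf : ((2 * t + 1).factorial : ℚ) ≠ 0 := by exact_mod_cast Nat.factorial_ne_zero _
  have h4 : (4 : ℚ) ^ (2 * t + 1 + 1) = 2 ^ (2 * t + 1 + 1) * 2 ^ (2 * t + 1 + 1) := by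
    rw [← mul_pow]; norm_num
  rw [h4] at h
  have hs : ((-1 : ℚ) ^ t) * (-1) ^ t = 1 := by rw [← mul_pow]; simp
  generalize (2 : ℚ) ^ (2 * t + 1 + 1) = P at *
  have ht : (t : ℚ) + 1 ≠ 0 := by positivity
  have ht2 : (2 * (t : ℚ) + 1 + 1) ≠ 0 := by positivity
  simp only [eq_ratCast, Rat.cast_id, pow_succ, Nat.cast_mul, Nat.cast_add, Nat.cast_one, Nat.cast_ofNat] at h ⊢
  field_simp at h ⊢
  generalize (-1 : ℚ) ^ t = s at *
  linear_combination (-s) * h - (tangentNumber (2 * t + 1) : ℚ) * (2 * t + 2) * hs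
end

section
/- For every real number x with |x| < π/2, the series ∑_{n=0}^{∞} S_n · x^n / n! converges and its sum equals 1 + tanh(x): that is, HasSum (fun n ↦ (S_n : ℝ) · x^n / n!) (1 + Real.tanh x). -/
/-- Homogeneous Eulerian weight. -/
noncomputable def wt {n : ℕ} (σ : Equiv.Perm (Fin n)) (a b : ℂ) : ℂ :=
  ∏ i, if i < σ i then a else b

/-- Homogeneous Eulerian polynomial. -/
noncomputable def WW (n : ℕ) (a b : ℂ) : ℂ := ∑ σ : Equiv.Perm (Fin n), wt σ a b

lemma wt_zero {n : ℕ} (σ : Equiv.Perm (Fin n)) (a b : ℂ) :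
    wt (Equiv.Perm.decomposeFin.symm (0, σ)) a b = b * wt σ a b := by
  unfold wt
  rw [Fin.prod_univ_succ]
  simp

lemma wt_succ {n : ℕ} (σ : Equiv.Perm (Fin n)) (j : Fin n) (a b : ℂ) :
    wt (Equiv.Perm.decomposeFin.symm ((σ j).succ, σ)) a b
      = a * b * ∏ i ∈ Finset.univ.erase j, if i < σ i then a else b := by
  unfold wt
  rw [Fin.prod_univ_succ, ← Finset.mul_prod_erase _ _ (Finset.mem_univ j)]
  simp only [Equiv.Perm.decomposeFin_symm_apply_zero, Equiv.Perm.decomposeFin_symm_apply_succ,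
    Fin.succ_pos, if_true, Equiv.swap_apply_right, Fin.not_lt_zero, if_false, mul_assoc]
  congr 2
  refine Finset.prod_congr rfl fun i hi => ?_
  have hij : i ≠ j := (Finset.mem_erase.mp hi).1
  rw [Equiv.swap_apply_of_ne_of_ne (Fin.succ_ne_zero _)
    (fun h => hij (σ.injective (Fin.succ_injective _ h)))]
  simp

lemma WW_succ (n : ℕ) (a b : ℂ) :
    WW (n + 1) a b = b * WW n a b + ∑ σ : Equiv.Perm (Fin n), ∑ j,
      a * b * ∏ i ∈ Finset.univ.erase j, if i < σ i then a else b := by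
  unfold WW
  rw [← Equiv.sum_comp Equiv.Perm.decomposeFin.symm, Fintype.sum_prod_type_right, Finset.mul_sum,
    ← Finset.sum_add_distrib]
  refine Finset.sum_congr rfl fun σ _ => ?_
  rw [Fin.sum_univ_succ, wt_zero, ← Equiv.sum_comp σ]
  simp only [wt_succ]

lemma WW_hasDerivAt (n : ℕ) (f g : ℂ → ℂ) (z : ℂ)
    (hf : HasDerivAt f (f z * g z) z) (hg : HasDerivAt g (f z * g z) z) :
    HasDerivAt (fun z => f z * WW n (f z) (g z)) (f z * WW (n + 1) (f z) (g z)) z := by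
  have h : HasDerivAt (fun z => WW n (f z) (g z)) (∑ σ : Equiv.Perm (Fin n), ∑ j,
      f z * g z * ∏ i ∈ Finset.univ.erase j, if i < σ i then f z else g z) z := by
    unfold WW wt
    refine HasDerivAt.fun_sum fun σ _ => ?_
    have := HasDerivAt.fun_finsetProd (u := Finset.univ)
      (f := fun i z => if i < σ i then f z else g z) (f' := fun _ => f z * g z) (x := z)
      (fun i _ => by split_ifs <;> assumption)
    refine this.congr_deriv ?_
    refine Finset.sum_congr rfl fun j _ => ?_
    rw [smul_eq_mul, mul_comm]
  refine (hf.mul h).congr_deriv ?_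
  rw [WW_succ]; ring

lemma WW_eq (n : ℕ) : WW n (-1) 1 = (S n : ℂ) := by
  unfold WW wt S exc
  push_cast
  refine Finset.sum_congr rfl fun σ _ => ?_
  rw [Finset.prod_ite]
  simp

lemma cosh_ne (z : ℂ) (hz : z ∈ Metric.ball (0 : ℂ) (Real.pi / 2)) : Complex.cosh z ≠ 0 := by
  rw [← Complex.cos_mul_I, Complex.cos_ne_zero_iff]
  intro k h
  have h1 := congrArg norm h
  have h2 : (((2 * k + 1) * Real.pi / 2 : ℂ)) = (((2 * k + 1 : ℤ) : ℝ) * (Real.pi / 2) : ℝ) := by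
    push_cast; ring
  rw [h2, Complex.norm_real, norm_mul, norm_mul, Complex.norm_I, mul_one, Real.norm_eq_abs,
    Real.norm_of_nonneg (by positivity)] at h1
  have h3 : (1 : ℝ) ≤ |((2 * k + 1 : ℤ) : ℝ)| := by
    rw [← Int.cast_abs]
    exact_mod_cast Int.one_le_abs (by omega)
  rw [mem_ball_zero_iff] at hz
  nlinarith [Real.pi_pos]

lemma tanh_deriv (z : ℂ) (hz : Complex.cosh z ≠ 0) :
    HasDerivAt Complex.tanh (1 - Complex.tanh z ^ 2) z := by
  have h := (Complex.hasDerivAt_sinh z).div (Complex.hasDerivAt_cosh z) hz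
  have e : Complex.tanh = Complex.sinh / Complex.cosh := by
    funext w; exact Complex.tanh_eq_sinh_div_cosh w
  rw [e]
  refine h.congr_deriv ?_
  simp only [Pi.div_apply]
  field_simp

lemma iter_eq (n : ℕ) : ∀ z ∈ Metric.ball (0 : ℂ) (Real.pi / 2),
    iteratedDeriv n (fun w => -1 - Complex.tanh w) z =
      (-1 - Complex.tanh z) * WW n (-1 - Complex.tanh z) (1 - Complex.tanh z) := by
  induction n with
  | zero => intro z _; simp [WW, wt]
  | succ n ih =>
    intro z hz
    rw [iteratedDeriv_succ]
    have he := Filter.eventuallyEq_of_mem (Metric.isOpen_ball.mem_nhds hz) ih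
    rw [he.deriv_eq]
    have ht := tanh_deriv z (cosh_ne z hz)
    refine (WW_hasDerivAt n (fun w => -1 - Complex.tanh w) (fun w => 1 - Complex.tanh w) z
      ?_ ?_).deriv
    · exact (ht.const_sub (-1)).congr_deriv (by ring)
    · exact (ht.const_sub 1).congr_deriv (by ring)

theorem egf_alternating_sum_excedances (x : ℝ) (hx : |x| < Real.pi / 2) :
    HasSum (fun n : ℕ => (S n : ℝ) * x ^ n / n.factorial) (1 + Real.tanh x) := by
  have hd : DifferentiableOn ℂ (fun w => -1 - Complex.tanh w) (Metric.ball 0 (Real.pi / 2)) :=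
    fun z hz => ((tanh_deriv z (cosh_ne z hz)).const_sub (-1)).differentiableAt.differentiableWithinAt
  have hxm : (x : ℂ) ∈ Metric.ball (0 : ℂ) (Real.pi / 2) := by
    rw [mem_ball_zero_iff, Complex.norm_real]; exact hx
  have h := (Complex.hasSum_taylorSeries_on_ball hd hxm).neg
  rw [← Complex.hasSum_ofReal]
  have e : -(-1 - Complex.tanh x) = ((1 + Real.tanh x : ℝ) : ℂ) := by push_cast; ring
  rw [e] at h
  have e2 : (fun n : ℕ => (((S n : ℝ) * x ^ n / n.factorial : ℝ) : ℂ)) = fun n : ℕ =>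
      -((n.factorial : ℂ)⁻¹ • ((x : ℂ) - 0) ^ n •
        iteratedDeriv n (fun w => -1 - Complex.tanh w) 0) := by
    funext n
    rw [iter_eq n 0 (by simp [Real.pi_pos])]
    simp only [Complex.tanh_zero, sub_zero, WW_eq, smul_eq_mul]
    push_cast
    ring
  rw [e2]
  exact h
end

section
/- For every integer n ≥ 1, the number of permutations of Fin (2n−1) with an even number of excedances differs from the number with an odd number of excedances by exactly the number of up-down alternating permutations of Fin (2n−1): |#{σ : exc(σ) even} − #{σ : exc(σ) odd}| equals the count of up-down alternating permutations of Fin (2n−1). -/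
open Finset Polynomial

namespace ExcGap

/-! ### The operator side -/

/-- The operator `(1 - y^2) d/dy`. -/
noncomputable def opD (f : ℤ[X]) : ℤ[X] := (1 - X ^ 2) * derivative f

/-- The twisted operator `D + y`. -/
noncomputable def opM (f : ℤ[X]) : ℤ[X] := opD f + X * f

lemma opD_add (f g : ℤ[X]) : opD (f + g) = opD f + opD g := by
  simp [opD, mul_add]

lemma opD_sum {ι : Type*} (s : Finset ι) (f : ι → ℤ[X]) :
    opD (∑ i ∈ s, f i) = ∑ i ∈ s, opD (f i) := by
  simp [opD, Finset.mul_sum]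

lemma opM_sum {ι : Type*} (s : Finset ι) (f : ι → ℤ[X]) :
    opM (∑ i ∈ s, f i) = ∑ i ∈ s, opM (f i) := by
  simp [opM, opD_sum, Finset.mul_sum, Finset.sum_add_distrib]

lemma opM_mul (c : ℕ) (f g : ℤ[X]) :
    opM (c • (f * g)) = c • (opD f * g) + c • (f * opM g) := by
  simp only [opM, opD, nsmul_eq_mul, derivative_mul, derivative_natCast]
  ring

lemma opM_iterate_mul (m : ℕ) (f g : ℤ[X]) :
    opM^[m] (f * g) =
      ∑ ij ∈ antidiagonal m, m.choose ij.1 • (opD^[ij.1] f * opM^[ij.2] g) := by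
  induction m with
  | zero => simp
  | succ m ih =>
    rw [Function.iterate_succ_apply', ih, opM_sum,
      Finset.sum_antidiagonal_choose_succ_nsmul (fun i j => opD^[i] f * opM^[j] g),
      ← Finset.sum_add_distrib]
    apply Finset.sum_congr rfl
    intro ij h
    rw [opM_mul, Function.iterate_succ_apply', Function.iterate_succ_apply']
    rw [Nat.choose_symm_of_eq_add (mem_antidiagonal.1 h).symm]
    ring

lemma opM_one : opM 1 = X := by simp [opM, opD]

lemma opM_X : opM X = 1 := by
  simp [opM, opD]; ring

lemma opM_iter_even (k : ℕ) : opM^[2 * k] 1 = 1 := by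
  induction k with
  | zero => simp
  | succ k ih =>
    rw [show 2 * (k + 1) = 2 * k + 1 + 1 by ring, Function.iterate_succ_apply,
      Function.iterate_succ_apply, opM_one, opM_X, ih]

lemma opM_iter_odd (k : ℕ) : opM^[2 * k + 1] 1 = X := by
  rw [Function.iterate_succ_apply', opM_iter_even, opM_one]

lemma sum_range_two_mul (f : ℕ → ℤ) (n : ℕ) :
    ∑ k ∈ range (2 * n), f k = ∑ k ∈ range n, (f (2 * k) + f (2 * k + 1)) := by
  induction n with
  | zero => simp
  | succ n ih =>
    rw [show 2 * (n + 1) = 2 * n + 1 + 1 by ring, sum_range_succ, sum_range_succ, ih,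
      sum_range_succ]
    ring

lemma opD_iter_shift (j : ℕ) : opD^[j + 1] (1 + X) = opD^[j + 1] X := by
  rw [Function.iterate_succ_apply, Function.iterate_succ_apply]
  congr 1
  simp [opD]

lemma tanh_rec (r : ℕ) :
    ∑ k ∈ range (r + 1), ((2 * r + 1).choose (2 * k) : ℤ) *
      (opD^[2 * r + 1 - 2 * k] (1 + X)).eval 0 = 1 := by
  have h1 := opM_iterate_mul (2 * r + 1) X 1
  have h2 : opM^[2 * r + 1] (X * 1) = 1 := by
    rw [mul_one, Function.iterate_succ_apply, opM_X, opM_iter_even]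
  rw [h2] at h1
  have h3 := congrArg (eval 0) h1
  rw [eval_finsetSum, ← Finset.Nat.sum_antidiagonal_swap] at h3
  rw [Finset.Nat.sum_antidiagonal_eq_sum_range_succ_mk] at h3
  rw [show (2 * r + 1).succ = 2 * (r + 1) by rw [Nat.succ_eq_add_one]; ring,
    sum_range_two_mul] at h3
  rw [eval_one] at h3
  rw [h3]
  apply Finset.sum_congr rfl
  intro k hk
  have hk' : k ≤ r := by simpa [Nat.lt_succ_iff] using hk
  simp only [Prod.swap, opM_iter_even, opM_iter_odd]
  rw [Nat.choose_symm (by omega)]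
  obtain ⟨j, hj⟩ : ∃ j, 2 * r + 1 - 2 * k = j + 1 := ⟨2 * r - 2 * k, by omega⟩
  rw [hj, opD_iter_shift]
  simp

/-! ### The excedance side -/

lemma exc_le {m : ℕ} (σ : Equiv.Perm (Fin m)) : exc σ ≤ m := by
  unfold exc
  exact (card_le_univ _).trans (by simp)

lemma exc_eq_sum {m : ℕ} (σ : Equiv.Perm (Fin m)) :
    exc σ = ∑ i, if i < σ i then 1 else 0 := by
  rw [exc, Finset.card_filter]

lemma exc_decompose_zero {m : ℕ} (e : Equiv.Perm (Fin m)) :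
    exc (Equiv.Perm.decomposeFin.symm (0, e)) = exc e := by
  rw [exc_eq_sum, exc_eq_sum, Fin.sum_univ_succ]
  simp

lemma exc_decompose_succ {m : ℕ} (e : Equiv.Perm (Fin m)) (i : Fin m) :
    exc (Equiv.Perm.decomposeFin.symm ((e i).succ, e)) + (if i < e i then 1 else 0) =
      exc e + 1 := by
  rw [exc_eq_sum, exc_eq_sum, Fin.sum_univ_succ]
  simp only [Equiv.Perm.decomposeFin_symm_apply_zero, Equiv.Perm.decomposeFin_symm_apply_succ]
  rw [← Finset.add_sum_erase univ _ (mem_univ i),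
    ← Finset.add_sum_erase univ (fun x => if x < e x then 1 else 0) (mem_univ i)]
  have : ∀ x ∈ univ.erase i,
      (if x.succ < Equiv.swap 0 (e i).succ (e x).succ then 1 else 0) =
      (if x < e x then 1 else 0) := by
    intro x hx
    have hx' : x ≠ i := by simpa using hx
    rw [Equiv.swap_apply_of_ne_of_ne (Fin.succ_ne_zero _)]
    · simp
    · simpa using hx'
  rw [Finset.sum_congr rfl this]
  simp
  ring

/-- The monomial attached to a permutation with `k` excedances. -/
noncomputable def wt (m k : ℕ) : ℤ[X] := (-1) ^ k * (1 + X) ^ (k + 1) * (1 - X) ^ (m - k)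

lemma opD_wt (m k : ℕ) (h : k ≤ m) :
    opD (wt m k) = (k + 1) * wt (m + 1) k + (m - k) * wt (m + 1) (k + 1) := by
  obtain ⟨j, rfl⟩ := Nat.exists_eq_add_of_le h
  simp only [wt, opD, Nat.add_sub_cancel_left, show k + j + 1 - k = j + 1 by omega,
    show k + j + 1 - (k + 1) = j by omega]
  rcases j with _ | j
  · simp [derivative_pow]
    ring
  · simp [derivative_pow]
    ring

lemma wt_sum {m : ℕ} (e : Equiv.Perm (Fin m)) :
    ∑ p, wt (m + 1) (exc (Equiv.Perm.decomposeFin.symm (p, e))) = opD (wt m (exc e)) := by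
  rw [opD_wt _ _ (exc_le e), Fin.sum_univ_succ, exc_decompose_zero,
    ← Equiv.sum_comp e]
  have : ∀ i : Fin m, wt (m + 1) (exc (Equiv.Perm.decomposeFin.symm ((e i).succ, e))) =
      (if i < e i then 1 else 0) * wt (m + 1) (exc e) +
        (1 - (if i < e i then 1 else 0)) * wt (m + 1) (exc e + 1) := by
    intro i
    have := exc_decompose_succ e i
    split_ifs at this ⊢ with h
    · rw [Nat.add_right_cancel this]; ring
    · rw [← this]; simp
  rw [Finset.sum_congr rfl (fun i _ => this i), Finset.sum_add_distrib, ← Finset.sum_mul,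
    ← Finset.sum_mul, Finset.sum_sub_distrib]
  have h2 : (∑ i : Fin m, if i < e i then (1 : ℤ[X]) else 0) = (exc e : ℤ[X]) := by
    rw [exc_eq_sum]; push_cast; rfl
  rw [h2]
  simp
  ring

lemma sum_wt (m : ℕ) :
    ∑ σ : Equiv.Perm (Fin m), wt m (exc σ) = opD^[m] (1 + X) := by
  induction m with
  | zero => simp [wt, exc]
  | succ m ih =>
    rw [Function.iterate_succ_apply', ← ih, opD_sum,
      ← Equiv.sum_comp (Equiv.Perm.decomposeFin (n := m)).symm, Fintype.sum_prod_type,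
      Finset.sum_comm]
    exact Finset.sum_congr rfl (fun e _ => wt_sum e)

lemma sum_sign (m : ℕ) :
    ∑ σ : Equiv.Perm (Fin m), (-1 : ℤ) ^ exc σ = (opD^[m] (1 + X)).eval 0 := by
  rw [← sum_wt, eval_finsetSum]
  simp [wt]

lemma gap_eq (m : ℕ) :
    ((Finset.univ.filter fun σ : Equiv.Perm (Fin m) => Even (exc σ)).card : ℤ) -
        ((Finset.univ.filter fun σ : Equiv.Perm (Fin m) => Odd (exc σ)).card : ℤ) =
      (opD^[m] (1 + X)).eval 0 := by
  rw [← sum_sign, Finset.card_filter, Finset.card_filter]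
  push_cast
  rw [← Finset.sum_sub_distrib]
  apply Finset.sum_congr rfl
  intro σ _
  rcases Nat.even_or_odd (exc σ) with h | h
  · simp [h, h.neg_one_pow]
  · simp [h, h.neg_one_pow]

/-! ### The alternating side -/

open scoped Classical in
/-- Number of up-down permutations of `Fin (m+1)` with first value `p`. -/
noncomputable def W (m p : ℕ) : ℕ :=
  (univ.filter fun σ : Equiv.Perm (Fin (m + 1)) => IsUpDown σ ∧ (σ 0 : ℕ) = p).card

/-- Insert the first value `p` in front of the complement of `τ`. -/
def ins {m : ℕ} (x : Fin (m + 1) × Equiv.Perm (Fin m)) : Equiv.Perm (Fin (m + 1)) :=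
  ((finSuccEquiv' 0).trans (Equiv.optionCongr (x.2.trans Fin.revPerm))).trans
    (finSuccEquiv' x.1).symm

lemma ins_zero {m : ℕ} (p : Fin (m + 1)) (τ : Equiv.Perm (Fin m)) : ins (p, τ) 0 = p := by
  simp [ins]

lemma ins_succ {m : ℕ} (p : Fin (m + 1)) (τ : Equiv.Perm (Fin m)) (i : Fin m) :
    ins (p, τ) i.succ = p.succAbove (τ i).rev := by
  have h : finSuccEquiv' (0 : Fin (m + 1)) i.succ = some i := by
    rw [← Fin.succAbove_zero_apply, finSuccEquiv'_succAbove]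
  simp [ins, h]

lemma ins_bij (m : ℕ) : Function.Bijective (ins (m := m)) := by
  rw [Fintype.bijective_iff_injective_and_card]
  constructor
  · rintro ⟨p, τ⟩ ⟨q, ρ⟩ h
    have h0 : p = q := by rw [← ins_zero p τ, h, ins_zero]
    subst h0
    have : τ = ρ := by
      ext i
      have := congrArg (fun s => s i.succ) h
      simp only [ins_succ] at this
      have := Fin.rev_injective (Fin.succAbove_right_injective this)
      rw [this]
    rw [this]
  · simp [Fintype.card_perm, Nat.factorial_succ]

lemma ins_upDown {m : ℕ} (p : Fin (m + 2)) (τ : Equiv.Perm (Fin (m + 1))) :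
    IsUpDown (ins (p, τ)) ↔ IsUpDown τ ∧ (τ 0 : ℕ) < m + 1 - p := by
  have key : ∀ (i : ℕ) (h : i < m + 1), ins (p, τ) ⟨i + 1, by omega⟩ =
      p.succAbove (τ ⟨i, h⟩).rev := fun i h => ins_succ p τ ⟨i, h⟩
  have hz : p < p.succAbove (τ 0).rev ↔ (τ 0 : ℕ) < m + 1 - p := by
    rw [Fin.lt_succAbove_iff_le_castSucc, Fin.le_def]
    simp only [Fin.val_castSucc, Fin.val_rev]
    have := (τ 0).isLt
    omega
  constructor
  · intro H
    constructor
    · intro i h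
      have := H (i + 1) (by omega)
      rw [key i (by omega), key (i + 1) h] at this
      simp only [Fin.succAbove_lt_succAbove_iff, Fin.rev_lt_rev] at this
      exact ⟨fun hi => this.2 hi.add_one, fun hi => this.1 hi.add_one⟩
    · have := (H 0 (by omega)).1 (by simp)
      rw [key 0 (by omega)] at this
      rw [← hz]
      convert this using 1
      · exact (ins_zero p τ).symm
      · rfl
  · rintro ⟨H, h0⟩ i h
    rcases i with _ | i
    · refine ⟨fun _ => ?_, fun h => by simp at h⟩
      rw [key 0 (by omega)]
      rw [← hz] at h0
      convert h0 using 1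
      · exact ins_zero p τ
      · rfl
    · have := H i (by omega)
      rw [key i (by omega), key (i + 1) (by omega)]
      simp only [Fin.succAbove_lt_succAbove_iff, Fin.rev_lt_rev]
      exact ⟨fun hi => this.2 (by grind), fun hi => this.1 (by grind)⟩

open scoped Classical in
lemma card_lt (m q : ℕ) :
    (univ.filter fun τ : Equiv.Perm (Fin (m + 1)) => IsUpDown τ ∧ (τ 0 : ℕ) < q).card =
      ∑ j ∈ range q, W m j := by
  rw [Finset.card_eq_sum_card_fiberwise (f := fun τ => (τ 0 : ℕ)) (t := range q)]
  · apply Finset.sum_congr rfl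
    intro j hj
    rw [W, Finset.filter_filter]
    congr 1
    ext τ
    simp only [mem_filter, mem_univ, true_and]
    have := mem_range.1 hj
    constructor
    · rintro ⟨⟨a, b⟩, c⟩
      exact ⟨a, c⟩
    · rintro ⟨a, c⟩
      exact ⟨⟨a, by omega⟩, c⟩
  · intro τ h
    simp at h
    simp [h.2]

lemma W_succ (m p : ℕ) : W (m + 1) p = ∑ j ∈ range (m + 1 - p), W m j := by
  classical
  by_cases hp : p < m + 2
  · rw [← card_lt, W]
    symm
    apply Finset.card_bij (fun τ _ => ins (⟨p, hp⟩, τ))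
    · intro τ h
      simp only [mem_filter, mem_univ, true_and] at h ⊢
      exact ⟨(ins_upDown _ _).2 h, by rw [ins_zero]⟩
    · intro τ _ ρ _ h
      have := (ins_bij (m + 1)).1 h
      simpa using this
    · intro σ h
      simp only [mem_filter, mem_univ, true_and] at h
      obtain ⟨⟨q, τ⟩, rfl⟩ := (ins_bij (m + 1)).2 σ
      rw [ins_zero, ins_upDown] at h
      obtain ⟨h1, rfl⟩ := h
      exact ⟨τ, by simpa using h1, rfl⟩
  · rw [show m + 1 - p = 0 by omega, W]
    simp
    intro σ _ h
    have := (σ 0).isLt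
    omega

lemma W_zero (p : ℕ) : W 0 p = if p = 0 then 1 else 0 := by
  classical
  have : ∀ σ : Equiv.Perm (Fin 1), IsUpDown σ := by
    intro σ i h
    omega
  unfold W
  split_ifs with h
  · subst h
    simp [this]
  · simp [this]
    omega

lemma card_upDown (m : ℕ) :
    Nat.card {σ : Equiv.Perm (Fin (m + 1)) // IsUpDown σ} = W (m + 1) 0 := by
  classical
  rw [W_succ, ← card_lt, Nat.card_eq_fintype_card, Fintype.card_subtype]
  congr 1
  ext σ
  simp
  intro _
  have := (σ 0).isLt
  omega

lemma sum_choose (p k : ℕ) :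
    ∑ i ∈ range p, ∑ j ∈ range i, (j.choose k : ℤ) = p.choose (k + 2) := by
  have h : ∀ (q k : ℕ), ∑ j ∈ range q, (j.choose k : ℤ) = q.choose (k + 1) := by
    intro q k
    induction q with
    | zero => simp
    | succ q ih => rw [sum_range_succ, ih, Nat.choose_succ_succ]; push_cast; ring
  simp only [h]

lemma W_step (r p : ℕ) (hp : p ≤ r + 2) :
    (W (r + 2) p : ℤ) = W (r + 2) 0 - ∑ i ∈ range p, ∑ j ∈ range i, (W r j : ℤ) := by
  induction p with
  | zero => simp
  | succ p ih =>
    have h1 := ih (by omega)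
    rw [sum_range_succ, ← sub_sub, ← h1, W_succ (r + 1) p, W_succ (r + 1) (p + 1)]
    rw [show r + 1 + 1 - p = (r + 1 - p) + 1 by omega,
      show r + 1 + 1 - (p + 1) = r + 1 - p by omega, sum_range_succ, W_succ r (r + 1 - p),
      show r + 1 - (r + 1 - p) = p by omega]
    push_cast
    ring

lemma W_formula (r p : ℕ) (hp : p ≤ 2 * r + 1) :
    (W (2 * r + 1) p : ℤ) =
      ∑ k ∈ range (r + 1), (-1) ^ k * (p.choose (2 * k) : ℤ) * W (2 * r + 1 - 2 * k) 0 +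
        (-1) ^ (r + 1) * p.choose (2 * r + 1) := by
  induction r generalizing p with
  | zero =>
    have : p = 0 ∨ p = 1 := by omega
    rcases this with rfl | rfl <;> simp [W_succ, W_zero]
  | succ r ih =>
    rw [show 2 * (r + 1) + 1 = 2 * r + 1 + 2 by ring, W_step _ _ (by omega)]
    have : ∑ i ∈ range p, ∑ j ∈ range i, (W (2 * r + 1) j : ℤ) =
        ∑ i ∈ range p, ∑ j ∈ range i,
          (∑ k ∈ range (r + 1), (-1) ^ k * (j.choose (2 * k) : ℤ) * W (2 * r + 1 - 2 * k) 0 +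
        (-1) ^ (r + 1) * j.choose (2 * r + 1)) := by
      refine Finset.sum_congr rfl fun i hi => Finset.sum_congr rfl fun j hj => ?_
      simp only [mem_range] at hi hj
      exact ih j (by omega)
    rw [this]
    simp only [Finset.sum_add_distrib, ← Finset.mul_sum, sum_choose]
    have h2 : ∑ i ∈ range p, ∑ j ∈ range i, ∑ k ∈ range (r + 1),
        (-1) ^ k * (j.choose (2 * k) : ℤ) * W (2 * r + 1 - 2 * k) 0 =
        ∑ k ∈ range (r + 1),
        (-1) ^ k * (p.choose (2 * k + 2) : ℤ) * W (2 * r + 1 - 2 * k) 0 := by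
      rw [Finset.sum_congr rfl (fun i _ => Finset.sum_comm), Finset.sum_comm]
      refine Finset.sum_congr rfl fun k _ => ?_
      simp only [← sum_choose, Finset.mul_sum, Finset.sum_mul]
    rw [h2, Finset.sum_range_succ' _ (r + 1)]
    have h3 : ∀ k, 2 * r + 1 + 2 - 2 * (k + 1) = 2 * r + 1 - 2 * k := by omega
    simp only [h3, show ∀ k, 2 * (k + 1) = 2 * k + 2 by intro; ring]
    simp only [pow_succ]
    simp
    ring

lemma tan_rec (r : ℕ) :
    ∑ k ∈ range (r + 1), (-1) ^ k * ((2 * r + 1).choose (2 * k) : ℤ) *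
      W (2 * r + 1 - 2 * k) 0 = (-1) ^ r := by
  have h := W_formula r (2 * r + 1) le_rfl
  rw [W_succ] at h
  simp [pow_succ] at h
  linarith

lemma main (r : ℕ) :
    (opD^[2 * r + 1] (1 + X)).eval 0 = (-1) ^ r * (W (2 * r + 1) 0 : ℤ) := by
  induction r using Nat.strong_induction_on with
  | _ r ih =>
    have h1 := tanh_rec r
    have h2 := tan_rec r
    rw [Finset.sum_range_succ'] at h1 h2
    have h3 : ∑ k ∈ range r, ((2 * r + 1).choose (2 * (k + 1)) : ℤ) *
        (opD^[2 * r + 1 - 2 * (k + 1)] (1 + X)).eval 0 =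
        (-1) ^ r * ∑ k ∈ range r, (-1) ^ (k + 1) * ((2 * r + 1).choose (2 * (k + 1)) : ℤ) *
      W (2 * r + 1 - 2 * (k + 1)) 0 := by
      rw [Finset.mul_sum]
      refine Finset.sum_congr rfl fun k hk => ?_
      have hk := mem_range.1 hk
      obtain ⟨s, rfl⟩ : ∃ s, r = s + (k + 1) := ⟨r - (k + 1), by omega⟩
      rw [show 2 * (s + (k + 1)) + 1 - 2 * (k + 1) = 2 * s + 1 by omega, ih s (by omega)]
      have : ((-1 : ℤ) ^ (k + 1)) * (-1) ^ (k + 1) = 1 := by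
        rw [← mul_pow]; simp
      rw [pow_add]
      linear_combination (-((2 * (s + (k + 1)) + 1).choose (2 * (k + 1)) : ℤ) *
        (-1) ^ s * W (2 * s + 1) 0) * this
    rw [h3] at h1
    have h4 : ((-1 : ℤ) ^ r) * (-1) ^ r = 1 := by
      rw [← mul_pow]; simp
    simp only [pow_zero, mul_zero, Nat.choose_zero_right, Nat.cast_one, one_mul, Nat.sub_zero] at h1 h2
    linear_combination h1 - (-1) ^ r * h2 - h4

end ExcGap

theorem excedance_parity_gap_eq_tangent_number (n : ℕ) (hn : 1 ≤ n) :
    |((Finset.univ.filter fun σ : Equiv.Perm (Fin (2 * n - 1)) => Even (exc σ)).card : ℤ) -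
        ((Finset.univ.filter fun σ : Equiv.Perm (Fin (2 * n - 1)) => Odd (exc σ)).card : ℤ)| =
      Nat.card {σ : Equiv.Perm (Fin (2 * n - 1)) // IsUpDown σ} := by
  obtain ⟨r, rfl⟩ : ∃ r, n = r + 1 := ⟨n - 1, by omega⟩
  rw [show 2 * (r + 1) - 1 = 2 * r + 1 by omega, ExcGap.gap_eq, ExcGap.main,
    ExcGap.card_upDown, abs_mul, abs_pow]
  simp
end
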